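/- arXiv:1604.07099 — 6 statements merged into one kernel-verified Lean document; each statement's English description precedes it below -/
import Mathlib

section
/- Let P ⊆ ℝ². Suppose we are given a family of 'crosses', where each cross consists of a point c together with a horizontal segment σ_H ⊆ P and a vertical segment σ_V ⊆ P such that c ∈ σ_H ∩ σ_V. Let S be a set of horizontal segments, each contained in P and inclusion-maximal in P. Then the following are equivalent: (i) for every cross in the family, some γ ∈ S intersects σ_H ∪ σ_V; (ii) for every cross in the family, some γ ∈ S intersects the vertical segment σ_V. -/
open Set

/-- A horizontal segment in ℝ²: a set of the form `[x₁,x₂] × {y}` with `x₁ ≤ x₂`. -/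
def IsHorizSeg (s : Set (ℝ × ℝ)) : Prop :=
  ∃ x₁ x₂ y : ℝ, x₁ ≤ x₂ ∧ s = Icc x₁ x₂ ×ˢ ({y} : Set ℝ)

/-- A vertical segment in ℝ²: a set of the form `{a} × [b₁,b₂]` with `b₁ ≤ b₂`. -/
def IsVertSeg (s : Set (ℝ × ℝ)) : Prop :=
  ∃ a b₁ b₂ : ℝ, b₁ ≤ b₂ ∧ s = ({a} : Set ℝ) ×ˢ Icc b₁ b₂

/-- A horizontal segment `γ ⊆ P` that is inclusion-maximal among horizontal segments in `P`. -/
def IsMaxHorizSeg (P γ : Set (ℝ × ℝ)) : Prop :=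
  IsHorizSeg γ ∧ γ ⊆ P ∧ ∀ σ : Set (ℝ × ℝ), IsHorizSeg σ → γ ⊆ σ → σ ⊆ P → σ = γ

/-- The union of two horizontal segments with a common point is a horizontal segment. -/
theorem IsHorizSeg.union {s t : Set (ℝ × ℝ)} (hs : IsHorizSeg s) (ht : IsHorizSeg t)
    (hst : (s ∩ t).Nonempty) : IsHorizSeg (s ∪ t) := by
  obtain ⟨x₁, x₂, y, hx, rfl⟩ := hs
  obtain ⟨x₃, x₄, z, hx', rfl⟩ := ht
  obtain ⟨p, ⟨⟨hp₁, hp₂⟩, rfl⟩, ⟨hp₃, hp₄⟩, rfl⟩ := hst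
  refine ⟨min x₁ x₃, max x₂ x₄, p.2, (min_le_left _ _).trans (hx.trans (le_max_left _ _)), ?_⟩
  rw [← union_prod, Icc_union_Icc' (hp₃.trans hp₂) (hp₁.trans hp₄)]

/-- A maximal horizontal segment contains every horizontal segment in `P` that it meets. -/
theorem IsMaxHorizSeg.subset_of_inter_nonempty {P γ σ : Set (ℝ × ℝ)} (hγ : IsMaxHorizSeg P γ)
    (hσ : IsHorizSeg σ) (hσP : σ ⊆ P) (h : (γ ∩ σ).Nonempty) : σ ⊆ γ :=
  union_eq_left.mp <|
    hγ.2.2 _ (hγ.1.union hσ h) subset_union_left (union_subset hγ.2.1 hσP)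

/-- Given a family of crosses (a point `c i` on a horizontal slice-segment
`σH i ⊆ P` and a vertical slice-segment `σV i ⊆ P`), a set `S` of inclusion-maximal
horizontal segments in `P` hits `σH i ∪ σV i` for every cross iff it hits the vertical
slice-segment `σV i` for every cross. -/
theorem horizontal_guards_hit_crosses_iff_hit_vertical (P : Set (ℝ × ℝ)) {ι : Type*}
    (c : ι → ℝ × ℝ) (σH σV : ι → Set (ℝ × ℝ))
    (hH : ∀ i, IsHorizSeg (σH i) ∧ σH i ⊆ P)
    (hV : ∀ i, IsVertSeg (σV i) ∧ σV i ⊆ P)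
    (hc : ∀ i, c i ∈ σH i ∩ σV i)
    (S : Set (Set (ℝ × ℝ))) (hS : ∀ γ ∈ S, IsMaxHorizSeg P γ) :
    (∀ i, ∃ γ ∈ S, (γ ∩ (σH i ∪ σV i)).Nonempty) ↔
      (∀ i, ∃ γ ∈ S, (γ ∩ σV i).Nonempty) := by
  refine ⟨fun h i ↦ ?_, fun h i ↦ ?_⟩
  · obtain ⟨γ, hγS, hγ⟩ := h i
    rw [inter_union_distrib_left, union_nonempty] at hγ
    refine ⟨γ, hγS, hγ.elim (fun hγH ↦ ?_) id⟩
    have hsub := (hS γ hγS).subset_of_inter_nonempty (hH i).1 (hH i).2 hγH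
    exact ⟨c i, hsub (hc i).1, (hc i).2⟩
  · obtain ⟨γ, hγS, hγ⟩ := h i
    exact ⟨γ, hγS, hγ.mono (inter_subset_inter_right _ subset_union_right)⟩
end

section
/- Let P ⊆ ℝ², let x₁ ≤ x₂ and let y, y' be real numbers, and set γ = [x₁,x₂]×{y} and γ' = [x₁,x₂]×{y'}. If the rectangle [x₁,x₂]×[min(y,y'), max(y,y')] is contained in P, then for every point p ∈ ℝ², p is visible from γ within P if and only if p is visible from γ' within P. -/
open Set

/-- A point `p = (pₓ, p_z)` is visible from the horizontal segment `[x₁,x₂] × {y}` within `P`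
if `pₓ ∈ [x₁,x₂]` and the vertical segment `{pₓ} × [min(p_z,y), max(p_z,y)]` lies in `P`. -/
def VisibleFromHoriz (P : Set (ℝ × ℝ)) (x₁ x₂ y : ℝ) (p : ℝ × ℝ) : Prop :=
  p.1 ∈ Icc x₁ x₂ ∧ ({p.1} : Set ℝ) ×ˢ Icc (min p.2 y) (max p.2 y) ⊆ P

/-- Visibility carries over from height `y` to height `y'` when the rectangle swept between the two
heights lies in `P`. -/
theorem VisibleFromHoriz.shift {P : Set (ℝ × ℝ)} {x₁ x₂ y y' : ℝ} {p : ℝ × ℝ}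
    (h : VisibleFromHoriz P x₁ x₂ y p)
    (hrect : Icc x₁ x₂ ×ˢ Icc (min y y') (max y y') ⊆ P) :
    VisibleFromHoriz P x₁ x₂ y' p := by
  refine ⟨h.1, ?_⟩
  rintro ⟨a, b⟩ ⟨rfl, hb⟩
  rcases uIcc_subset_uIcc_union_uIcc (b := y) hb with hb | hb
  · exact h.2 ⟨rfl, hb⟩
  · exact hrect ⟨h.1, hb⟩

/-- A parallel shift of a horizontal sliding camera does not change its
visibility region, provided the rectangle swept between the two positions lies in `P`. -/
theorem parallel_shift_preserves_visibility (P : Set (ℝ × ℝ)) (x₁ x₂ y y' : ℝ)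
    (hx : x₁ ≤ x₂)
    (hrect : Icc x₁ x₂ ×ˢ Icc (min y y') (max y y') ⊆ P) :
    ∀ p : ℝ × ℝ, VisibleFromHoriz P x₁ x₂ y p ↔ VisibleFromHoriz P x₁ x₂ y' p := by
  intro p
  refine ⟨fun h => h.shift hrect, fun h => h.shift ?_⟩
  rwa [min_comm, max_comm]
end

section
/- Let U be a finite set partitioned into two disjoint subsets U_H and U_V, let 𝒮 be a family of subsets of U, and let r > 0 be a real number. Suppose T_H ⊆ U_H satisfies: for every s ∈ 𝒮 with 2r·|s ∩ U_H| ≥ |U_H|, the set T_H ∩ s is nonempty; and suppose T_V ⊆ U_V satisfies: for every s ∈ 𝒮 with 2r·|s ∩ U_V| ≥ |U_V|, the set T_V ∩ s is nonempty. Then for every s ∈ 𝒮 with r·|s| ≥ |U|, the set (T_H ∪ T_V) ∩ s is nonempty. -/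
open Finset

/-- If `T_H` is a `(1/2r)`-net for the subsystem induced on `U_H` and `T_V` is a
`(1/2r)`-net for the subsystem induced on `U_V`, where `U` is partitioned into `U_H` and `U_V`,
then `T_H ∪ T_V` is a `(1/r)`-net for the set system `(U, 𝒮)`. -/
theorem union_of_nets_is_net {α : Type*} [DecidableEq α]
    (U U_H U_V : Finset α) (hdisj : Disjoint U_H U_V) (hU : U = U_H ∪ U_V)
    (𝒮 : Set (Finset α)) (h𝒮 : ∀ s ∈ 𝒮, s ⊆ U)
    (r : ℝ) (hr : 0 < r)
    (T_H : Finset α) (hTH : T_H ⊆ U_H)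
    (hTHnet : ∀ s ∈ 𝒮, 2 * r * ((s ∩ U_H).card : ℝ) ≥ (U_H.card : ℝ) →
      (T_H ∩ s).Nonempty)
    (T_V : Finset α) (hTV : T_V ⊆ U_V)
    (hTVnet : ∀ s ∈ 𝒮, 2 * r * ((s ∩ U_V).card : ℝ) ≥ (U_V.card : ℝ) →
      (T_V ∩ s).Nonempty) :
    ∀ s ∈ 𝒮, r * (s.card : ℝ) ≥ (U.card : ℝ) → ((T_H ∪ T_V) ∩ s).Nonempty := by
  intro s hs hcard
  have hs_card : s.card = (s ∩ U_H).card + (s ∩ U_V).card := by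
    rw [← card_union_of_disjoint (hdisj.mono inter_subset_right inter_subset_right),
      ← inter_union_distrib_left, ← hU, inter_eq_left.mpr (h𝒮 s hs)]
  rw [hU, card_union_of_disjoint hdisj, hs_card] at hcard
  push_cast at hcard
  rw [union_inter_distrib_right]
  by_cases hH : 2 * r * ((s ∩ U_H).card : ℝ) ≥ (U_H.card : ℝ)
  · exact (hTHnet s hs hH).mono subset_union_left
  · refine (hTVnet s hs ?_).mono subset_union_right
    have : 0 ≤ r * ((s ∩ U_H).card : ℝ) := by positivity
    have : 0 ≤ r * ((s ∩ U_V).card : ℝ) := by positivity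
    linarith
end

section
/- Let 0 < c ≤ a and 0 < b ≤ d be real numbers, and let P = ([0,a]×[0,b]) ∪ ([0,c]×[0,d]) be the corresponding L-shaped orthogonal region. Then there exists a horizontal segment γ contained in P such that every point p ∈ P is visible from γ within P. (For instance, γ = [0,a]×{y} for any y ∈ [0,b] works.) -/
open Set

/-- An L-shaped orthogonal region
`P = ([0,a]×[0,b]) ∪ ([0,c]×[0,d])` with `0 < c ≤ a` and `0 < b ≤ d`
can be guarded by a single horizontal sliding camera. -/
theorem L_shape_guarded_by_one_horizontal_camera (a b c d : ℝ)
    (hc : 0 < c) (hca : c ≤ a) (hb : 0 < b) (hbd : b ≤ d)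
    (P : Set (ℝ × ℝ))
    (hP : P = (Icc (0:ℝ) a ×ˢ Icc (0:ℝ) b) ∪ (Icc (0:ℝ) c ×ˢ Icc (0:ℝ) d)) :
    ∃ x₁ x₂ y : ℝ, x₁ ≤ x₂ ∧ (Icc x₁ x₂ ×ˢ ({y} : Set ℝ)) ⊆ P ∧
      ∀ p ∈ P, VisibleFromHoriz P x₁ x₂ y p := by
  subst hP
  refine ⟨0, a, 0, hc.le.trans hca, ?_, ?_⟩
  · rintro ⟨x, y⟩ ⟨hx, rfl⟩
    exact Or.inl ⟨hx, le_rfl, hb.le⟩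
  · rintro ⟨x, z⟩ (⟨hx, hz⟩ | ⟨hx, hz⟩)
    · refine ⟨hx, ?_⟩
      rintro ⟨_, w⟩ ⟨rfl, hw⟩
      rw [min_eq_right hz.1, max_eq_left hz.1] at hw
      exact Or.inl ⟨hx, hw.1, hw.2.trans hz.2⟩
    · refine ⟨⟨hx.1, hx.2.trans hca⟩, ?_⟩
      rintro ⟨_, w⟩ ⟨rfl, hw⟩
      rw [min_eq_right hz.1, max_eq_left hz.1] at hw
      exact Or.inr ⟨hx, hw.1, hw.2.trans hz.2⟩
end

section
/- Let P ⊆ ℝ², let R = [a₁,a₂]×[b₁,b₂] with a₁ ≤ a₂ and b₁ ≤ b₂ be an axis-parallel rectangle with R ⊆ P, and let γ be a horizontal segment contained in P that is inclusion-maximal in P. If γ ∩ R ≠ ∅, then every point of R is visible from γ within P. -/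
open Set

/-- If `R = [a₁,a₂]×[b₁,b₂] ⊆ P` is an axis-parallel rectangle and
`γ = [x₁,x₂]×{y}` is an inclusion-maximal horizontal segment in `P` intersecting `R`,
then every point of `R` is visible from `γ` within `P`. -/
theorem maximal_camera_sees_whole_rectangle (P : Set (ℝ × ℝ))
    (a₁ a₂ b₁ b₂ : ℝ) (ha : a₁ ≤ a₂) (hb : b₁ ≤ b₂)
    (hR : Icc a₁ a₂ ×ˢ Icc b₁ b₂ ⊆ P)
    (x₁ x₂ y : ℝ) (hx : x₁ ≤ x₂)
    (hγP : Icc x₁ x₂ ×ˢ ({y} : Set ℝ) ⊆ P)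
    (hmax : ∀ σ : Set (ℝ × ℝ), IsHorizSeg σ → Icc x₁ x₂ ×ˢ ({y} : Set ℝ) ⊆ σ →
      σ ⊆ P → σ = Icc x₁ x₂ ×ˢ ({y} : Set ℝ))
    (hint : ((Icc x₁ x₂ ×ˢ ({y} : Set ℝ)) ∩ (Icc a₁ a₂ ×ˢ Icc b₁ b₂)).Nonempty) :
    ∀ p ∈ Icc a₁ a₂ ×ˢ Icc b₁ b₂, VisibleFromHoriz P x₁ x₂ y p := by
  obtain ⟨⟨u, v⟩, ⟨⟨hu₁, hu₂⟩, hv⟩, ⟨hu₃, hu₄⟩, hv₁, hv₂⟩ := hint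
  obtain rfl : v = y := hv
  dsimp only at hu₁ hu₂ hu₃ hu₄ hv₁ hv₂
  have hunion : Icc (min x₁ a₁) (max x₂ a₂) ×ˢ ({v} : Set ℝ) ⊆ P := by
    rintro ⟨s, t⟩ ⟨⟨hs₁, hs₂⟩, ht⟩
    obtain rfl : t = v := ht
    dsimp only at hs₁ hs₂
    by_cases hs : s ∈ Icc x₁ x₂
    · exact hγP ⟨hs, rfl⟩
    · refine hR ⟨?_, hv₁, hv₂⟩
      grind
  have heq := hmax _ ⟨_, _, v, (min_le_left _ _).trans (hx.trans (le_max_left _ _)), rfl⟩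
    (prod_mono (Icc_subset_Icc (min_le_left _ _) (le_max_left _ _)) Subset.rfl) hunion
  rintro ⟨p, q⟩ ⟨⟨hp₁, hp₂⟩, hq₁, hq₂⟩
  dsimp only at hp₁ hp₂ hq₁ hq₂
  have hp : (p, v) ∈ Icc x₁ x₂ ×ˢ ({v} : Set ℝ) :=
    heq ▸ ⟨⟨(min_le_right _ _).trans hp₁, hp₂.trans (le_max_right _ _)⟩, rfl⟩
  refine ⟨hp.1, ?_⟩
  rintro ⟨s, t⟩ ⟨hs, ht₁, ht₂⟩
  obtain rfl : s = p := hs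
  exact hR ⟨⟨hp₁, hp₂⟩, (le_min hq₁ hv₁).trans ht₁, ht₂.trans (max_le hq₂ hv₂)⟩
end

section
/- Let x₀ ≤ x₁ ≤ x₂ ≤ x₃ and y₁ ≤ y₂ be real numbers. Let R_M = [x₁,x₂]×[y₁,y₂], let R_L = [x₀,x₁]×[l₁,l₂] with y₁ ≤ l₁ ≤ l₂ ≤ y₂, and let R_R = [x₂,x₃]×[r₁,r₂] with y₁ ≤ r₁ ≤ r₂ ≤ y₂, and set P = R_L ∪ R_M ∪ R_R. Then for every m ∈ [x₁,x₂], the vertical segment γ = {m}×[y₁,y₂] is contained in P and every point of P is visible from γ within P. -/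
open Set

/-- A point `p = (pₓ, p_z)` is visible from the vertical segment `{a} × [b₁,b₂]` within `P`
if `p_z ∈ [b₁,b₂]` and the horizontal segment `[min(pₓ,a), max(pₓ,a)] × {p_z}` lies in `P`. -/
def VisibleFromVert (P : Set (ℝ × ℝ)) (a b₁ b₂ : ℝ) (p : ℝ × ℝ) : Prop :=
  p.2 ∈ Icc b₁ b₂ ∧ Icc (min p.1 a) (max p.1 a) ×ˢ ({p.2} : Set ℝ) ⊆ P

/-- For a polygon `P = R_L ∪ R_M ∪ R_R` consisting of a middle rectangle
`R_M = [x₁,x₂]×[y₁,y₂]` and left/right rectangles whose vertical extent is contained in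
`[y₁,y₂]`, any vertical segment `{m}×[y₁,y₂]` with `m ∈ [x₁,x₂]` lies in `P` and
guards all of `P`. -/
theorem vertical_camera_in_middle_slice_guards (x₀ x₁ x₂ x₃ y₁ y₂ l₁ l₂ r₁ r₂ : ℝ)
    (h01 : x₀ ≤ x₁) (h12 : x₁ ≤ x₂) (h23 : x₂ ≤ x₃) (hy : y₁ ≤ y₂)
    (hl1 : y₁ ≤ l₁) (hl : l₁ ≤ l₂) (hl2 : l₂ ≤ y₂)
    (hr1 : y₁ ≤ r₁) (hr : r₁ ≤ r₂) (hr2 : r₂ ≤ y₂)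
    (P : Set (ℝ × ℝ))
    (hP : P = (Icc x₀ x₁ ×ˢ Icc l₁ l₂) ∪ (Icc x₁ x₂ ×ˢ Icc y₁ y₂) ∪
      (Icc x₂ x₃ ×ˢ Icc r₁ r₂))
    (m : ℝ) (hm : m ∈ Icc x₁ x₂) :
    (({m} : Set ℝ) ×ˢ Icc y₁ y₂) ⊆ P ∧ ∀ p ∈ P, VisibleFromVert P m y₁ y₂ p := by
  subst hP
  obtain ⟨hm1, hm2⟩ := hm
  constructor
  · rintro ⟨x, y⟩ ⟨rfl, h⟩
    exact Or.inl (Or.inr ⟨⟨hm1, hm2⟩, h⟩)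
  · rintro ⟨a, b⟩ hp
    simp only [mem_union, mem_prod, mem_Icc] at hp
    refine ⟨⟨?_, ?_⟩, ?_⟩
    · grind
    · grind
    · rintro ⟨x, y⟩ ⟨⟨hx1, hx2⟩, rfl⟩
      simp only [mem_union, mem_prod, mem_Icc]
      grind
end
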